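/- Strongly TRO equivalent operator algebras with countable approximate identities are strongly stably isomorphic: Let H, K be complex Hilbert spaces, let A ⊆ B(H) and B ⊆ B(K) be norm-closed subalgebras acting nondegenerately, each possessing a countable approximate identity, and let M ⊆ B(H,K) be a TRO with A = [M*BM] and B = [MAM*]. Then there exists a bijective algebra homomorphism φ : K_∞(A) → K_∞(B) that is completely isometric (hence its inverse is also completely isometric). -/

import Mathlib

noncomputable section

open ContinuousLinearMap

/-- The norm-closed linear span of a set of operators. -/
def clspan {V : Type*} [NormedAddCommGroup V] [NormedSpace ℂ V] (S : Set V) : Set V :=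
  closure (Submodule.span ℂ S : Set V)

/-- A set is a norm-closed linear subspace. -/
def IsClosedSubspace {V : Type*} [NormedAddCommGroup V] [NormedSpace ℂ V] (S : Set V) : Prop :=
  IsClosed S ∧ ∃ p : Submodule ℂ V, (p : Set V) = S

variable {H K L R : Type*}
  [NormedAddCommGroup H] [InnerProductSpace ℂ H] [CompleteSpace H]
  [NormedAddCommGroup K] [InnerProductSpace ℂ K] [CompleteSpace K]
  [NormedAddCommGroup L] [InnerProductSpace ℂ L] [CompleteSpace L]
  [NormedAddCommGroup R] [InnerProductSpace ℂ R] [CompleteSpace R]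

/-- A ternary ring of operators: a norm-closed subspace `M ⊆ B(H,K)` with `M M* M ⊆ M`. -/
def IsTRO (M : Set (H →L[ℂ] K)) : Prop :=
  IsClosedSubspace M ∧
    ∀ m₁ ∈ M, ∀ m₂ ∈ M, ∀ m₃ ∈ M, m₁ ∘L ((adjoint m₂) ∘L m₃) ∈ M

/-- A norm-closed subalgebra of `B(H)`. -/
def IsClosedSubalgebra (A : Set (H →L[ℂ] H)) : Prop :=
  IsClosedSubspace A ∧ ∀ a ∈ A, ∀ b ∈ A, a * b ∈ A

/-- `[M* B M]`, the norm-closed linear span of `{m₁* b m₂ : m₁, m₂ ∈ M, b ∈ B}`. -/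
def conjTRO (M : Set (H →L[ℂ] K)) (B : Set (K →L[ℂ] K)) : Set (H →L[ℂ] H) :=
  clspan {x | ∃ m₁ ∈ M, ∃ m₂ ∈ M, ∃ b ∈ B, x = (adjoint m₁) ∘L (b ∘L m₂)}

/-- `[M A M*]`, the norm-closed linear span of `{m₁ a m₂* : m₁, m₂ ∈ M, a ∈ A}`. -/
def conjTRO' (M : Set (H →L[ℂ] K)) (A : Set (H →L[ℂ] H)) : Set (K →L[ℂ] K) :=
  clspan {x | ∃ m₁ ∈ M, ∃ m₂ ∈ M, ∃ a ∈ A, x = m₁ ∘L (a ∘L (adjoint m₂))}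

/-- An algebra `A ⊆ B(H)` acts nondegenerately: the span of `A(H)` is dense in `H`. -/
def Nondegenerate (A : Set (H →L[ℂ] H)) : Prop :=
  Dense (Submodule.span ℂ {v : H | ∃ a ∈ A, ∃ h : H, v = a h} : Set H)

/-- A contractive approximate identity for `A`: a net `(e t)` in the unit ball of `A`
with `‖e t * a - a‖ → 0` and `‖a * e t - a‖ → 0` for every `a ∈ A`. -/
def HasCai (A : Set (H →L[ℂ] H)) : Prop :=
  ∃ (ι : Type) (_ : Preorder ι) (_ : IsDirected ι (· ≤ ·)) (_ : Nonempty ι)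
    (e : ι → (H →L[ℂ] H)),
    (∀ t, e t ∈ A) ∧ (∀ t, ‖e t‖ ≤ 1) ∧
    ∀ a ∈ A, Filter.Tendsto (fun t => ‖e t * a - a‖) Filter.atTop (nhds 0) ∧
      Filter.Tendsto (fun t => ‖a * e t - a‖) Filter.atTop (nhds 0)

/-- A countable approximate identity for `A`: a sequence `(e n)` in `A` with
`‖e n * a - a‖ → 0` and `‖a * e n - a‖ → 0` for every `a ∈ A`. -/
def HasCountableAI (A : Set (H →L[ℂ] H)) : Prop :=
  ∃ e : ℕ → (H →L[ℂ] H), (∀ n, e n ∈ A) ∧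
    ∀ a ∈ A, Filter.Tendsto (fun n => ‖e n * a - a‖) Filter.atTop (nhds 0) ∧
      Filter.Tendsto (fun n => ‖a * e n - a‖) Filter.atTop (nhds 0)

/-- The operator on the ℓ²-direct sum `R^n` associated to an `n × n` matrix of operators. -/
def matrixOp {n : ℕ} (x : Fin n → Fin n → (R →L[ℂ] R)) :
    (PiLp 2 fun _ : Fin n => R) →L[ℂ] (PiLp 2 fun _ : Fin n => R) :=
  ((PiLp.continuousLinearEquiv 2 ℂ (fun _ : Fin n => R)).symm.toContinuousLinearMap.comp
      (ContinuousLinearMap.pi fun i =>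
        ∑ j, (x i j).comp (ContinuousLinearMap.proj j))).comp
    (PiLp.continuousLinearEquiv 2 ℂ (fun _ : Fin n => R)).toContinuousLinearMap

/-- `φ` is completely isometric on a subspace `A ⊆ B(R)`: every matrix amplification of `φ`
preserves the operator matrix norms. -/
def CompletelyIsometricOn (A : Set (R →L[ℂ] R)) (φ : (R →L[ℂ] R) → (H →L[ℂ] H)) : Prop :=
  ∀ (n : ℕ) (x : Fin n → Fin n → (R →L[ℂ] R)), (∀ i j, x i j ∈ A) →
    ‖matrixOp (fun i j => φ (x i j))‖ = ‖matrixOp x‖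

/-- `α` is a completely isometric nondegenerate representation of the operator algebra
`A ⊆ B(R)` on the Hilbert space `H`: it is linear and multiplicative on `A`,
completely isometric on `A`, and the span of `α(A)H` is dense in `H`. -/
def IsCIRepOn (A : Set (R →L[ℂ] R)) (α : (R →L[ℂ] R) → (H →L[ℂ] H)) : Prop :=
  (∀ a ∈ A, ∀ b ∈ A, α (a + b) = α a + α b) ∧
  (∀ (c : ℂ), ∀ a ∈ A, α (c • a) = c • α a) ∧
  (∀ a ∈ A, ∀ b ∈ A, α (a * b) = α a * α b) ∧
  CompletelyIsometricOn A α ∧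
  Dense (Submodule.span ℂ {v : H | ∃ a ∈ A, ∃ h : H, v = α a h} : Set H)

/-- Two concretely represented operator algebras are strongly TRO equivalent. -/
def StronglyTROEquivalent (X : Set (H →L[ℂ] H)) (Y : Set (K →L[ℂ] K)) : Prop :=
  ∃ M : Set (H →L[ℂ] K), IsTRO M ∧ X = conjTRO M Y ∧ Y = conjTRO' M X

/-- Two operator algebras are strongly Δ-equivalent: they admit completely isometric
nondegenerate representations with strongly TRO equivalent ranges. -/
def StronglyDeltaEquivalent (A : Set (H →L[ℂ] H)) (B : Set (K →L[ℂ] K)) : Prop :=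
  ∃ (H' K' : Type) (_ : NormedAddCommGroup H') (_ : InnerProductSpace ℂ H')
    (_ : CompleteSpace H') (_ : NormedAddCommGroup K') (_ : InnerProductSpace ℂ K')
    (_ : CompleteSpace K')
    (α : (H →L[ℂ] H) → (H' →L[ℂ] H')) (β : (K →L[ℂ] K) → (K' →L[ℂ] K')),
    IsCIRepOn A α ∧ IsCIRepOn B β ∧ StronglyTROEquivalent (α '' A) (β '' B)

/-- The Hilbert space `ℓ²(H)` of square-summable sequences in `H`. -/
abbrev l2 (H : Type*) [NormedAddCommGroup H] [InnerProductSpace ℂ H] : Type _ :=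
  lp (fun _ : ℕ => H) 2

/-- The isometric embedding `S_i` of `H` onto the `i`-th coordinate of `ℓ²(H)`. -/
def lpSingle (i : ℕ) : H →L[ℂ] l2 H :=
  LinearMap.mkContinuous
    { toFun := fun a => lp.single 2 i a
      map_add' := fun a b => by
        apply lp.ext
        funext j
        by_cases h : j = i
        · subst h; simp [lp.single_apply_self]
        · simp [lp.single_apply_ne _ _ _ h, lp.coeFn_add]
      map_smul' := fun c a => by simp }
    1 (fun a => by
      simpa using (lp.norm_single (p := 2) (by norm_num) (fun _ : ℕ => a) i).le)

/-- The stabilization `K_∞(A) = [{S_i a S_j* : a ∈ A, i, j ∈ ℕ}] ⊆ B(ℓ²(H))`. -/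
def Kinf (A : Set (H →L[ℂ] H)) : Set (l2 H →L[ℂ] l2 H) :=
  clspan {x | ∃ a ∈ A, ∃ i j : ℕ, x = (lpSingle i) ∘L (a ∘L (adjoint (lpSingle j)))}


section aux
open Filter Topology
open scoped InnerProductSpace
set_option linter.unusedSectionVars false
variable {G : Type*} [NormedAddCommGroup G] [InnerProductSpace ℂ G] [CompleteSpace G]
variable {V W : Type*} [NormedAddCommGroup V] [NormedSpace ℂ V] [NormedAddCommGroup W] [NormedSpace ℂ W]

/-- closed span as a submodule -/
def csp (S : Set V) : Submodule ℂ V := (Submodule.span ℂ S).topologicalClosure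

theorem mem_clspan_iff {S : Set V} {x : V} : x ∈ clspan S ↔ x ∈ csp S := by
  unfold clspan csp
  rw [← SetLike.mem_coe, Submodule.topologicalClosure_coe]

theorem csp_closed (S : Set V) : IsClosed (csp S : Set V) :=
  Submodule.isClosed_topologicalClosure _

theorem mem_csp {S : Set V} {x : V} (h : x ∈ S) : x ∈ csp S :=
  Submodule.le_topologicalClosure _ (Submodule.subset_span h)

theorem csp_map {S : Set V} (Q : Submodule ℂ W) (hQ : IsClosed (Q : Set W)) (f : V → W)
    (hf : Continuous f) (hadd : ∀ x y, f (x + y) = f x + f y)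
    (hsmul : ∀ (c : ℂ) x, ∃ c' : ℂ, f (c • x) = c' • f x)
    (h : ∀ s ∈ S, f s ∈ Q) {x : V} (hx : x ∈ csp S) : f x ∈ Q := by
  have h0 : f 0 = 0 := by
    have := hadd 0 0
    simpa using this
  have hcl : IsClosed (f ⁻¹' (Q : Set W)) := hQ.preimage hf
  have hsp : (Submodule.span ℂ S : Set V) ⊆ f ⁻¹' (Q : Set W) := by
    intro y hy
    refine Submodule.span_induction (p := fun y _ => f y ∈ Q) h ?_ ?_ ?_ hy
    · rw [h0]; exact Q.zero_mem
    · intro a b _ _ ha hb; rw [hadd]; exact Q.add_mem ha hb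
    · intro c a _ ha
      obtain ⟨c', hc⟩ := hsmul c a
      rw [hc]; exact Q.smul_mem _ ha
  have : (csp S : Set V) ⊆ f ⁻¹' (Q : Set W) := by
    unfold csp
    rw [Submodule.topologicalClosure_coe]
    exact closure_minimal hsp hcl
  exact this hx

/-- operators killed in the limit -/
def nullSub (T : ℕ → (H →L[ℂ] H)) : Submodule ℂ (G →L[ℂ] H) where
  carrier := {z | Tendsto (fun n => (T n) ∘L z) atTop (𝓝 0)}
  zero_mem' := by simp
  add_mem' := by
    intro a b ha hb
    have := Tendsto.add ha hb
    simpa [ContinuousLinearMap.comp_add] using this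
  smul_mem' := by
    intro c a ha
    have := Tendsto.const_smul ha c
    simpa [ContinuousLinearMap.comp_smul] using this

theorem nullSub_closed (T : ℕ → (H →L[ℂ] H)) (hT : ∀ n, ‖T n‖ ≤ 1) :
    IsClosed (nullSub (G := G) T : Set (G →L[ℂ] H)) := by
  rw [← isSeqClosed_iff_isClosed]
  intro u z hu hz
  show Tendsto (fun n => (T n) ∘L z) atTop (𝓝 0)
  rw [Metric.tendsto_atTop]
  intro ε hε
  rw [Metric.tendsto_atTop] at hz
  obtain ⟨N, hN⟩ := hz (ε / 2) (by positivity)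
  have h1 := hN N le_rfl
  have h2 : Tendsto (fun n => (T n) ∘L (u N)) atTop (𝓝 0) := hu N
  rw [Metric.tendsto_atTop] at h2
  obtain ⟨N', hN'⟩ := h2 (ε / 2) (by positivity)
  refine ⟨N', fun n hn => ?_⟩
  have h3 := hN' n hn
  rw [dist_zero_right] at h3 ⊢
  have h4 : (T n) ∘L z = (T n) ∘L (u N) - (T n) ∘L (u N - z) := by
    rw [← ContinuousLinearMap.comp_sub]; congr 1; abel
  have h5 : ‖(T n) ∘L (u N - z)‖ ≤ 1 * ‖u N - z‖ :=
    (opNorm_comp_le _ _).trans (mul_le_mul_of_nonneg_right (hT n) (norm_nonneg _))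
  rw [dist_eq_norm] at h1
  rw [h4]
  have := norm_sub_le ((T n) ∘L (u N)) ((T n) ∘L (u N - z))
  linarith

theorem nullSub_comp {G' : Type*} [NormedAddCommGroup G'] [InnerProductSpace ℂ G']
    (T : ℕ → (H →L[ℂ] H)) {z : G →L[ℂ] H} (hz : z ∈ nullSub T) (w : G' →L[ℂ] G) :
    z ∘L w ∈ nullSub T := by
  show Tendsto (fun n => (T n) ∘L (z ∘L w)) atTop (𝓝 0)
  have h : Tendsto (fun n => (T n) ∘L z) atTop (𝓝 0) := hz
  have hc : Continuous (fun y : G →L[ℂ] H => y ∘L w) := by fun_prop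
  have := (hc.tendsto 0).comp h
  simpa [Function.comp_def, ContinuousLinearMap.comp_assoc] using this

/-- recursive sequence -/
def Tseq (x : ℕ → (H →L[ℂ] K)) : ℕ → (H →L[ℂ] H)
  | 0 => 1
  | n + 1 => Tseq x n - (adjoint (x n ∘L Tseq x n)) ∘L (x n ∘L Tseq x n)

theorem Tseq_sa (x : ℕ → (H →L[ℂ] K)) (n : ℕ) : adjoint (Tseq x n) = Tseq x n := by
  induction n with
  | zero => exact star_one (R := H →L[ℂ] H)
  | succ n ih =>
    simp only [Tseq, map_sub, adjoint_comp, adjoint_adjoint, ih]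

theorem Tseq_sum (x : ℕ → (H →L[ℂ] K)) (n : ℕ) :
    Tseq x n = 1 - ∑ i ∈ Finset.range n, (adjoint (x i ∘L Tseq x i)) ∘L (x i ∘L Tseq x i) := by
  induction n with
  | zero => simp [Tseq]
  | succ n ih =>
    rw [Finset.sum_range_succ, Tseq]
    nth_rewrite 1 [ih]
    abel

theorem Tseq_inv (x : ℕ → (H →L[ℂ] K)) (hx : ∀ n, ‖x n‖ ≤ 1) (n : ℕ) : ∀ ξ : H,
    ‖Tseq x n ξ‖ ^ 2 + ∑ i ∈ Finset.range n, ‖x i (Tseq x n ξ)‖ ^ 2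
      ≤ RCLike.re ⟪Tseq x n ξ, ξ⟫_ℂ := by
  induction n with
  | zero =>
    intro ξ
    have : RCLike.re ⟪ξ, ξ⟫_ℂ = ‖ξ‖ ^ 2 := inner_self_eq_norm_sq ξ
    simp only [Tseq, one_apply_eq_self, Finset.range_zero, Finset.sum_empty, add_zero]
    exact this.ge
  | succ n ih =>
    intro ξ
    set T := Tseq x n with hT
    have hsa : adjoint T = T := Tseq_sa x n
    set w := x n (T ξ) with hw
    have e1 : Tseq x (n + 1) ξ = T (ξ - adjoint (x n) w) := by
      simp [Tseq, adjoint_comp, ← hT, hsa, hw]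
    have i1 := ih (ξ - adjoint (x n) w)
    have i2 := ih (adjoint (x n) w)
    rw [e1, Finset.sum_range_succ]
    have e2 : ⟪T (ξ - adjoint (x n) w), ξ - adjoint (x n) w⟫_ℂ =
        ⟪T (ξ - adjoint (x n) w), ξ⟫_ℂ - ⟪x n (T (ξ - adjoint (x n) w)), w⟫_ℂ := by
      rw [inner_sub_right, adjoint_inner_right]
    rw [e2, map_sub (RCLike.re : ℂ →+ ℝ)] at i1
    set y := x n (T (adjoint (x n) w)) with hy
    have e3 : x n (T (ξ - adjoint (x n) w)) = w - y := by simp [hw, hy]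
    rw [e3] at i1 ⊢
    have e4 : ⟪T (adjoint (x n) w), adjoint (x n) w⟫_ℂ = ⟪y, w⟫_ℂ := by
      rw [adjoint_inner_right]
    rw [e4] at i2
    have i3 : ‖y‖ ≤ ‖T (adjoint (x n) w)‖ := by
      refine (le_opNorm _ _).trans ?_
      exact mul_le_of_le_one_left (norm_nonneg _) (hx n)
    have i4 : ‖y‖ ^ 2 ≤ ‖T (adjoint (x n) w)‖ ^ 2 := by gcongr
    have i5 : 0 ≤ ∑ i ∈ Finset.range n, ‖x i (T (adjoint (x n) w))‖ ^ 2 := by positivity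
    have i6 : ‖w - y‖ ^ 2 ≤ RCLike.re ⟪w - y, w⟫_ℂ := by
      rw [@norm_sub_sq ℂ, inner_sub_left, map_sub, inner_self_eq_norm_sq, inner_re_symm w y]
      linarith
    linarith

theorem Tseq_pos (x : ℕ → (H →L[ℂ] K)) (hx : ∀ n, ‖x n‖ ≤ 1) (n : ℕ) (ξ : H) :
    ‖Tseq x n ξ‖ ^ 2 ≤ RCLike.re ⟪Tseq x n ξ, ξ⟫_ℂ := by
  have := Tseq_inv x hx n ξ
  have i5 : 0 ≤ ∑ i ∈ Finset.range n, ‖x i (Tseq x n ξ)‖ ^ 2 := by positivity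
  linarith

theorem le_of_sq_le_mul {a b : ℝ} (ha : 0 ≤ a) (hb : 0 ≤ b) (h : a ^ 2 ≤ a * b) : a ≤ b := by
  rcases ha.eq_or_lt with h0 | h0
  · rw [← h0]; exact hb
  · nlinarith

theorem Tseq_norm (x : ℕ → (H →L[ℂ] K)) (hx : ∀ n, ‖x n‖ ≤ 1) (n : ℕ) : ‖Tseq x n‖ ≤ 1 := by
  refine opNorm_le_bound _ zero_le_one fun ξ => ?_
  rw [one_mul]
  exact le_of_sq_le_mul (norm_nonneg _) (norm_nonneg _)
    ((Tseq_pos x hx n ξ).trans (re_inner_le_norm _ _))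

open Classical in
theorem Tseq_bound (x : ℕ → (H →L[ℂ] K)) (hx : ∀ n, ‖x n‖ ≤ 1) (n p : ℕ) (z : H →L[ℂ] K)
    
    (hp : p + 1 ≤ ((Finset.range n).filter (fun i => x i = z)).card) :
    ‖Tseq x n ∘L adjoint z‖ ^ 2 ≤ 1 / ((p : ℝ) + 1) := by
  have hpp : (0 : ℝ) < (p : ℝ) + 1 := by positivity
  have key : ∀ k, ‖(Tseq x n ∘L adjoint z) k‖ ^ 2 ≤ 1 / ((p : ℝ) + 1) * ‖k‖ ^ 2 := by
    intro k
    set ξ := adjoint z k with hξ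
    have h1 := Tseq_inv x hx n ξ
    have h2 : ((p : ℝ) + 1) * ‖z (Tseq x n ξ)‖ ^ 2 ≤ ∑ i ∈ Finset.range n, ‖x i (Tseq x n ξ)‖ ^ 2 := by
      calc ((p : ℝ) + 1) * ‖z (Tseq x n ξ)‖ ^ 2
          ≤ (((Finset.range n).filter (fun i => x i = z)).card : ℝ) * ‖z (Tseq x n ξ)‖ ^ 2 := by
            gcongr; exact_mod_cast hp
        _ = ∑ i ∈ (Finset.range n).filter (fun i => x i = z), ‖x i (Tseq x n ξ)‖ ^ 2 := by
            rw [← nsmul_eq_mul, ← Finset.sum_const]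
            refine Finset.sum_congr rfl fun i hi => ?_
            rw [(Finset.mem_filter.1 hi).2]
        _ ≤ _ := Finset.sum_le_sum_of_subset_of_nonneg (Finset.filter_subset _ _)
            (fun i _ _ => by positivity)
    have h3 : ⟪Tseq x n ξ, ξ⟫_ℂ = ⟪z (Tseq x n ξ), k⟫_ℂ := by
      rw [hξ, adjoint_inner_right]
    have h4 : RCLike.re ⟪Tseq x n ξ, ξ⟫_ℂ ≤ ‖z (Tseq x n ξ)‖ * ‖k‖ := by
      rw [h3]; exact re_inner_le_norm _ _
    have h5 : ((p : ℝ) + 1) * ‖z (Tseq x n ξ)‖ ≤ ‖k‖ := by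
      have h0 : 0 ≤ ‖Tseq x n ξ‖ ^ 2 := by positivity
      rcases (norm_nonneg (z (Tseq x n ξ))).eq_or_lt with h | h
      · rw [← h]; simp
      · have : ((p : ℝ) + 1) * ‖z (Tseq x n ξ)‖ ^ 2 ≤ ‖z (Tseq x n ξ)‖ * ‖k‖ := by linarith
        nlinarith
    have h6 : 0 ≤ ((p : ℝ) + 1) * ‖z (Tseq x n ξ)‖ ^ 2 := by positivity
    have h7 : ‖Tseq x n ξ‖ ^ 2 ≤ ‖z (Tseq x n ξ)‖ * ‖k‖ := by linarith
    show ‖Tseq x n ξ‖ ^ 2 ≤ _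
    rw [div_mul_eq_mul_div, le_div_iff₀ hpp]
    nlinarith [norm_nonneg k]
  have hs : ‖Tseq x n ∘L adjoint z‖ ≤ Real.sqrt (1 / ((p : ℝ) + 1)) := by
    refine opNorm_le_bound _ (Real.sqrt_nonneg _) fun k => ?_
    refine (pow_le_pow_iff_left₀ (norm_nonneg _) (by positivity) two_ne_zero).1 ?_
    rw [mul_pow, Real.sq_sqrt (by positivity)]
    exact key k
  calc _ ≤ Real.sqrt (1 / ((p : ℝ) + 1)) ^ 2 := by gcongr
    _ = _ := Real.sq_sqrt (by positivity)

/-- generators -/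
def gen (C : Set (H →L[ℂ] K)) (B : Set (K →L[ℂ] K)) : Set (H →L[ℂ] H) :=
  {x | ∃ m₁ ∈ C, ∃ m₂ ∈ C, ∃ b ∈ B, x = (adjoint m₁) ∘L (b ∘L m₂)}

theorem gen_mono {C C' : Set (H →L[ℂ] K)} (h : C ⊆ C') (B : Set (K →L[ℂ] K)) :
    gen C B ⊆ gen C' B := by
  rintro x ⟨m₁, h1, m₂, h2, b, hb, rfl⟩
  exact ⟨m₁, h h1, m₂, h h2, b, hb, rfl⟩

theorem csp_mono {S S' : Set V} (h : S ⊆ S') : csp S ≤ csp S' :=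
  Submodule.topologicalClosure_mono (Submodule.span_mono h)

theorem exists_countable {M : Set (H →L[ℂ] K)} {B : Set (K →L[ℂ] K)} {e : H →L[ℂ] H}
    (he : e ∈ conjTRO M B) : ∃ C ⊆ M, C.Countable ∧ e ∈ csp (gen C B) := by
  have hspan : ∀ y ∈ Submodule.span ℂ (gen M B),
      ∃ C ⊆ M, C.Countable ∧ y ∈ csp (gen C B) := by
    intro y hy
    induction hy using Submodule.span_induction with
    | mem x hx =>
      obtain ⟨m₁, h1, m₂, h2, b, hb, rfl⟩ := hx
      refine ⟨{m₁, m₂}, ?_, (Set.toFinite _).countable, mem_csp ⟨m₁, by simp, m₂, by simp, b, hb, rfl⟩⟩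
      rintro z (rfl | rfl) <;> assumption
    | zero => exact ⟨∅, Set.empty_subset _, Set.countable_empty, Submodule.zero_mem _⟩
    | add x y _ _ hx hy =>
      obtain ⟨C, hC, hC', hx⟩ := hx
      obtain ⟨D, hD, hD', hy⟩ := hy
      exact ⟨C ∪ D, Set.union_subset hC hD, hC'.union hD', Submodule.add_mem _
        (csp_mono (gen_mono Set.subset_union_left B) hx)
        (csp_mono (gen_mono Set.subset_union_right B) hy)⟩
    | smul c x _ hx =>
      obtain ⟨C, hC, hC', hx⟩ := hx
      exact ⟨C, hC, hC', Submodule.smul_mem _ _ hx⟩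
  obtain ⟨u, hu, hlim⟩ := mem_closure_iff_seq_limit.1 he
  choose C hC hC' hmem using fun n => hspan (u n) (hu n)
  refine ⟨⋃ n, C n, Set.iUnion_subset hC, Set.countable_iUnion hC', ?_⟩
  exact (csp_closed _).mem_of_tendsto hlim (Eventually.of_forall fun n =>
    csp_mono (gen_mono (Set.subset_iUnion C n) B) (hmem n))

theorem Tseq_null (z : ℕ → (H →L[ℂ] K)) (hz : ∀ n, ‖z n‖ ≤ 1) (k : ℕ) :
    adjoint (z k) ∈ nullSub (Tseq (fun n => z (Nat.unpair n).1)) := by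
  classical
  set x : ℕ → (H →L[ℂ] K) := fun n => z (Nat.unpair n).1 with hx
  have hx1 : ∀ n, ‖x n‖ ≤ 1 := fun n => hz _
  show Tendsto (fun n => Tseq x n ∘L adjoint (z k)) atTop (𝓝 0)
  rw [Metric.tendsto_atTop]
  intro ε hε
  obtain ⟨p, hp⟩ := exists_nat_one_div_lt (show (0 : ℝ) < ε ^ 2 by positivity)
  refine ⟨Nat.pair k p + 1, fun n hn => ?_⟩
  have hc : p + 1 ≤ ((Finset.range n).filter (fun i => x i = z k)).card := by
    have : (Finset.range (p + 1)).image (fun q => Nat.pair k q) ⊆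
        (Finset.range n).filter (fun i => x i = z k) := by
      intro i hi
      obtain ⟨q, hq, rfl⟩ := Finset.mem_image.1 hi
      have hq' : q ≤ p := by
        have := Finset.mem_range.1 hq
        omega
      refine Finset.mem_filter.2 ⟨Finset.mem_range.2 ?_, by simp [hx]⟩
      have : Nat.pair k q ≤ Nat.pair k p := by
        rcases hq'.eq_or_lt with h | h
        · rw [h]
        · exact (Nat.pair_lt_pair_right k h).le
      omega
    have h2 := Finset.card_le_card this
    rw [Finset.card_image_of_injective, Finset.card_range] at h2
    · exact h2
    · intro a b hab
      exact (Nat.pair_eq_pair.1 hab).2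
  have hb := Tseq_bound x hx1 n p (z k) hc
  rw [dist_zero_right]
  refine (pow_lt_pow_iff_left₀ (norm_nonneg _) hε.le two_ne_zero).1 ?_
  exact hb.trans_lt hp

theorem exists_seq {M : Set (H →L[ℂ] K)} (hM : IsTRO M) {A : Set (H →L[ℂ] H)}
    {B : Set (K →L[ℂ] K)} (hAB : A = conjTRO M B) (hAnd : Nondegenerate A)
    (hAai : HasCountableAI A) :
    ∃ m : ℕ → (H →L[ℂ] K), (∀ i, m i ∈ M) ∧
      (∀ h, HasSum (fun i => ‖m i h‖ ^ 2) (‖h‖ ^ 2)) ∧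
      (∀ n, ‖1 - ∑ i ∈ Finset.range n, (adjoint (m i)) ∘L (m i)‖ ≤ 1) ∧
      (∀ a ∈ A, a ∈ nullSub (fun n => 1 - ∑ i ∈ Finset.range n, (adjoint (m i)) ∘L (m i))) ∧
      (∀ a ∈ A, adjoint a ∈
        nullSub (fun n => 1 - ∑ i ∈ Finset.range n, (adjoint (m i)) ∘L (m i))) := by
  obtain ⟨⟨-, p, hp⟩, hM3⟩ := hM
  obtain ⟨e, heA, he⟩ := hAai
  choose C hCM hCc hCe using fun n => exists_countable (hAB ▸ heA n)
  have hcount : (insert 0 (⋃ n, C n)).Countable := (Set.countable_iUnion hCc).insert 0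
  obtain ⟨c, hc⟩ := hcount.exists_eq_range (Set.insert_nonempty _ _)
  have hcM : ∀ k, c k ∈ M := by
    intro k
    have : c k ∈ insert 0 (⋃ n, C n) := hc ▸ Set.mem_range_self k
    rcases this with h | h
    · rw [h, ← hp]; exact p.zero_mem
    · obtain ⟨n, hn⟩ := Set.mem_iUnion.1 h
      exact hCM n hn
  set z : ℕ → (H →L[ℂ] K) := fun k => (((1 + ‖c k‖)⁻¹ : ℝ) : ℂ) • c k with hzdef
  have hz1 : ∀ k, ‖z k‖ ≤ 1 := by
    intro k
    have h0 : 0 < 1 + ‖c k‖ := by positivity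
    rw [hzdef]
    simp only [norm_smul, Complex.norm_real, norm_inv, Real.norm_eq_abs, abs_of_pos h0]
    rw [inv_mul_le_iff₀ h0]; linarith
  have hzM : ∀ k, z k ∈ M := by
    intro k
    have := hcM k
    rw [← hp] at this ⊢
    exact p.smul_mem _ this
  set x : ℕ → (H →L[ℂ] K) := fun n => z (Nat.unpair n).1 with hx
  have hx1 : ∀ n, ‖x n‖ ≤ 1 := fun n => hz1 _
  set T := Tseq x with hT
  have hMT : ∀ n, ∀ y ∈ M, y ∘L T n ∈ M := by
    intro n
    induction n with
    | zero => intro y hy; exact hy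
    | succ n ih =>
      intro y hy
      have h1 := ih y hy
      have h2 := ih (x n) (hzM _)
      have h3 := hM3 y hy _ h2 _ h2
      have e1 : y ∘L T (n + 1) = y ∘L T n - y ∘L (adjoint (x n ∘L T n) ∘L (x n ∘L T n)) := by
        rw [← ContinuousLinearMap.comp_sub]; rfl
      rw [e1]
      rw [← hp] at h1 h3 ⊢
      exact p.sub_mem h1 h3
  have hTsum : (fun n => 1 - ∑ i ∈ Finset.range n, (adjoint (x i ∘L T i)) ∘L (x i ∘L T i)) = T := by
    funext n; exact (Tseq_sum x n).symm
  have hTn : ∀ n, ‖T n‖ ≤ 1 := Tseq_norm x hx1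
  have hcnull : ∀ k, adjoint (c k) ∈ nullSub T := by
    intro k
    have h1 := Tseq_null z hz1 k
    have h0 : (((1 + ‖c k‖) : ℝ) : ℂ) ≠ 0 := by
      have : 0 < 1 + ‖c k‖ := by positivity
      exact_mod_cast this.ne'
    have h2 : c k = (((1 + ‖c k‖) : ℝ) : ℂ) • z k := by
      rw [hzdef]
      simp only [smul_smul]
      rw [Complex.ofReal_inv, mul_inv_cancel₀ h0, one_smul]
    rw [h2, map_smulₛₗ]
    exact Submodule.smul_mem _ _ h1
  have hgen : ∀ n, ∀ y ∈ C n, adjoint y ∈ nullSub T := by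
    intro n y hy
    have : y ∈ insert 0 (⋃ n, C n) := Or.inr (Set.mem_iUnion.2 ⟨n, hy⟩)
    rw [hc] at this
    obtain ⟨k, rfl⟩ := this
    exact hcnull k
  have hcl : IsClosed (nullSub (G := H) T : Set (H →L[ℂ] H)) := nullSub_closed T hTn
  have he1 : ∀ n, e n ∈ nullSub T := by
    intro n
    refine csp_map (nullSub T) hcl (fun y => y) continuous_id (fun _ _ => rfl)
      (fun c _ => ⟨c, rfl⟩) ?_ (hCe n)
    rintro s ⟨m₁, h1, m₂, h2, b, hb, rfl⟩
    exact nullSub_comp T (hgen n m₁ h1) _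
  have he2 : ∀ n, adjoint (e n) ∈ nullSub T := by
    intro n
    refine csp_map (nullSub T) hcl (fun y => adjoint y) (by fun_prop) (fun _ _ => map_add _ _ _)
      (fun c _ => ⟨_, map_smulₛₗ _ _ _⟩) ?_ (hCe n)
    rintro s ⟨m₁, h1, m₂, h2, b, hb, rfl⟩
    have := nullSub_comp T (hgen n m₂ h2) (adjoint b ∘L m₁)
    simpa [adjoint_comp, ContinuousLinearMap.comp_assoc] using this
  have hA1 : ∀ a ∈ A, a ∈ nullSub T := by
    intro a ha
    have h1 : Tendsto (fun n => e n * a) atTop (𝓝 a) :=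
      tendsto_iff_norm_sub_tendsto_zero.2 (he a ha).1
    exact hcl.mem_of_tendsto h1 (Eventually.of_forall fun n => nullSub_comp T (he1 n) a)
  have hA2 : ∀ a ∈ A, adjoint a ∈ nullSub T := by
    intro a ha
    have h1 : Tendsto (fun n => a * e n) atTop (𝓝 a) :=
      tendsto_iff_norm_sub_tendsto_zero.2 (he a ha).2
    have hcont : Continuous (fun y : H →L[ℂ] H => adjoint y) := by fun_prop
    have h2 := (hcont.tendsto a).comp h1
    refine hcl.mem_of_tendsto h2 (Eventually.of_forall fun n => ?_)
    have := nullSub_comp T (he2 n) (adjoint a)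
    rwa [← adjoint_comp] at this
  -- strong convergence
  have hstrong : ∀ h : H, Tendsto (fun n => T n h) atTop (𝓝 0) := by
    intro h
    let q : Submodule ℂ H :=
      { carrier := {h | Tendsto (fun n => T n h) atTop (𝓝 0)}
        zero_mem' := by simp
        add_mem' := by
          intro a b ha hb
          have := Tendsto.add ha hb
          simpa using this
        smul_mem' := by
          intro c a ha
          have := Tendsto.const_smul ha c
          simpa using this }
    have hq : IsClosed (q : Set H) := by
      rw [← isSeqClosed_iff_isClosed]
      intro u z hu hz
      show Tendsto (fun n => T n z) atTop (𝓝 0)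
      rw [Metric.tendsto_atTop] at hz ⊢
      intro ε hε
      obtain ⟨N, hN⟩ := hz (ε / 2) (by positivity)
      have h1 := hN N le_rfl
      have h2 : Tendsto (fun n => T n (u N)) atTop (𝓝 0) := hu N
      rw [Metric.tendsto_atTop] at h2
      obtain ⟨N', hN'⟩ := h2 (ε / 2) (by positivity)
      refine ⟨N', fun n hn => ?_⟩
      have h3 := hN' n hn
      rw [dist_zero_right] at h3 ⊢
      have h4 : T n z = T n (u N) - T n (u N - z) := by rw [map_sub]; abel
      have h5 : ‖T n (u N - z)‖ ≤ 1 * ‖u N - z‖ :=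
        (le_opNorm _ _).trans (mul_le_mul_of_nonneg_right (hTn n) (norm_nonneg _))
      rw [dist_eq_norm] at h1
      rw [h4]
      have := norm_sub_le (T n (u N)) (T n (u N - z))
      linarith
    have hsub : Submodule.span ℂ {v : H | ∃ a ∈ A, ∃ h : H, v = a h} ≤ q := by
      rw [Submodule.span_le]
      rintro v ⟨a, ha, h, rfl⟩
      have h1 : Tendsto (fun n => T n ∘L a) atTop (𝓝 0) := hA1 a ha
      have hcont : Continuous (fun y : H →L[ℂ] H => y h) := by fun_prop
      have := (hcont.tendsto 0).comp h1
      show Tendsto (fun n => T n (a h)) atTop (𝓝 0)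
      simpa [Function.comp_def] using this
    have : closure (Submodule.span ℂ {v : H | ∃ a ∈ A, ∃ h : H, v = a h} : Set H) ⊆ q :=
      closure_minimal hsub hq
    exact this (hAnd h)
  refine ⟨fun i => x i ∘L T i, fun i => hMT i _ (hzM _), ?_, ?_, ?_, ?_⟩
  · intro h
    rw [hasSum_iff_tendsto_nat_of_nonneg (fun i => by positivity)]
    have e1 : ∀ n, ∑ i ∈ Finset.range n, ‖(x i ∘L T i) h‖ ^ 2 =
        ‖h‖ ^ 2 - RCLike.re ⟪T n h, h⟫_ℂ := by
      intro n
      have : T n h = h - ∑ i ∈ Finset.range n, adjoint (x i ∘L T i) ((x i ∘L T i) h) := by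
        rw [← congrFun hTsum n]; simp
      rw [this, inner_sub_left, map_sub, inner_self_eq_norm_sq, sum_inner, map_sum]
      simp only [adjoint_inner_left, inner_self_eq_norm_sq]
      ring
    simp only [e1]
    have h2 : Tendsto (fun n => RCLike.re ⟪T n h, h⟫_ℂ) atTop (𝓝 0) := by
      have hcont : Continuous (fun y : H => RCLike.re ⟪y, h⟫_ℂ) := by fun_prop
      have := (hcont.tendsto 0).comp (hstrong h)
      simpa [Function.comp_def] using this
    simpa using tendsto_const_nhds.sub h2
  · intro n
    rw [congrFun hTsum n]; exact hTn n
  · rw [hTsum]; exact hA1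
  · rw [hTsum]; exact hA2

theorem adj_single (i : ℕ) (f : l2 H) : adjoint (lpSingle i) f = f i := by
  refine ext_inner_left ℂ fun v => ?_
  rw [adjoint_inner_right]
  exact lp.inner_single_left (𝕜 := ℂ) (G := fun _ : ℕ => H) i v f

theorem single_coe (i j : ℕ) (a : H) : (lpSingle j a : l2 H) i = if i = j then a else 0 := by
  show (lp.single 2 j a : l2 H) i = _
  rw [lp.single_apply]
  split_ifs with h
  · subst h; simp
  · simp [h]

theorem single_inner (i j : ℕ) (a b : H) (h : i ≠ j) :
    ⟪(lpSingle i a : l2 H), lpSingle j b⟫_ℂ = 0 := by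
  rw [← adjoint_inner_right, adj_single, single_coe, if_neg h, inner_zero_right]

theorem single_norm (i : ℕ) (a : H) : ‖(lpSingle i a : l2 H)‖ = ‖a‖ :=
  lp.norm_single (E := fun _ : ℕ => H) (p := 2) (by norm_num) i a

theorem ext_single {Y : Type*} [NormedAddCommGroup Y] [InnerProductSpace ℂ Y]
    (P Q : l2 H →L[ℂ] Y) (h : ∀ i a, P (lpSingle i a) = Q (lpSingle i a)) : P = Q := by
  ext f
  have h1 : HasSum (fun i => (lpSingle i (f i) : l2 H)) f := lp.hasSum_single (by norm_num) f
  have h2 := h1.mapL P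
  have h3 := h1.mapL Q
  simp only [h] at h2
  exact h2.unique h3

theorem mkIso {Y : Type*} [NormedAddCommGroup Y] [InnerProductSpace ℂ Y] [CompleteSpace Y]
    (F : ℕ → (H →L[ℂ] Y)) (hF : ∀ i h, ‖F i h‖ = ‖h‖)
    (hO : ∀ i j, i ≠ j → ∀ v w, ⟪F i v, F j w⟫_ℂ = 0) :
    ∃ T : l2 H →L[ℂ] Y, (∀ x, adjoint T (T x) = x) ∧ ∀ i h, T (lpSingle i h) = F i h := by
  let V : ∀ i : ℕ, H →ₗᵢ[ℂ] Y := fun i => ⟨(F i).toLinearMap, hF i⟩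
  have hV : OrthogonalFamily ℂ (fun _ : ℕ => H) V := fun i j hij v w => hO i j hij v w
  refine ⟨hV.linearIsometry.toContinuousLinearMap, ?_, fun i h => ?_⟩
  · intro x
    have := (norm_map_iff_adjoint_comp_self (hV.linearIsometry.toContinuousLinearMap)).1
      (fun x => hV.linearIsometry.norm_map x)
    exact congrArg (fun T => T x) this
  · exact hV.linearIsometry_apply_single h

/-- column module -/
def col (N : Set (G →L[ℂ] H)) : Submodule ℂ (G →L[ℂ] l2 H) :=
  csp {y | ∃ i, ∃ n ∈ N, y = lpSingle i ∘L n}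

/-- adjointable maps -/
def Mor {X Y : Type*} [NormedAddCommGroup X] [InnerProductSpace ℂ X] [CompleteSpace X]
    [NormedAddCommGroup Y] [InnerProductSpace ℂ Y] [CompleteSpace Y]
    (CX : Submodule ℂ (G →L[ℂ] X)) (CY : Submodule ℂ (G →L[ℂ] Y)) (T : X →L[ℂ] Y) : Prop :=
  (∀ c ∈ CX, T ∘L c ∈ CY) ∧ (∀ c ∈ CY, adjoint T ∘L c ∈ CX)

theorem col_map {X : Type*} [NormedAddCommGroup X] [InnerProductSpace ℂ X]
    {N : Set (G →L[ℂ] H)} (Q : Submodule ℂ (G →L[ℂ] X)) (hQ : IsClosed (Q : Set (G →L[ℂ] X)))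
    (T : l2 H →L[ℂ] X) (h : ∀ i, ∀ n ∈ N, T ∘L (lpSingle i ∘L n) ∈ Q) :
    ∀ c ∈ col N, T ∘L c ∈ Q := by
  intro c hc
  refine csp_map Q hQ (fun y => T ∘L y) (by fun_prop) (fun _ _ => comp_add _ _ _)
      (fun c _ => ⟨c, comp_smul _ _ _⟩) ?_ hc
  rintro s ⟨i, n, hn, rfl⟩
  exact h i n hn

theorem reindex (σ : ℕ → ℕ) (hσ : Function.Injective σ) :
    ∃ T : l2 H →L[ℂ] l2 H, (∀ x, adjoint T (T x) = x) ∧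
      (∀ i h, T (lpSingle i h) = lpSingle (σ i) h) ∧
      (∀ k h, (∀ i, σ i ≠ k) → adjoint T (lpSingle k h) = 0) := by
  obtain ⟨T, h1, h2⟩ := mkIso (H := H) (Y := l2 H) (fun i => lpSingle (σ i))
    (fun i h => single_norm _ _) (fun i j hij v w => single_inner _ _ _ _ (fun h => hij (hσ h)))
  refine ⟨T, h1, h2, fun k h hk => ?_⟩
  apply lp.ext
  funext j
  rw [← adj_single]
  refine ext_inner_left ℂ fun v => ?_
  rw [adjoint_inner_right, adjoint_inner_right, h2, single_inner _ _ _ _ (hk j)]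
  simp

theorem reindex_mor {σ : ℕ → ℕ} {T : l2 H →L[ℂ] l2 H} (h0 : ∀ x, adjoint T (T x) = x)
    (h1 : ∀ i h, T (lpSingle i h) = lpSingle (σ i) h)
    (h2 : ∀ k h, (∀ i, σ i ≠ k) → adjoint T (lpSingle k h) = 0) (N : Set (G →L[ℂ] H)) :
    Mor (col N) (col N) T := by
  constructor
  · refine col_map _ (csp_closed _) _ fun i n hn => mem_csp ⟨σ i, n, hn, ?_⟩
    ext v
    simp [h1]
  · refine col_map _ (csp_closed _) _ fun k n hn => ?_
    by_cases hk : ∃ i, σ i = k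
    · obtain ⟨i, rfl⟩ := hk
      refine mem_csp ⟨i, n, hn, ?_⟩
      ext1 v
      simp only [comp_apply]
      rw [← h1, h0]
    · push Not at hk
      have : adjoint T ∘L (lpSingle k ∘L n) = 0 := by
        ext1 v
        simp only [comp_apply]
        rw [h2 _ _ hk]; rfl
      rw [this]; exact Submodule.zero_mem _

theorem exists_V0 (m : ℕ → (H →L[ℂ] K)) (hm : ∀ h, HasSum (fun i => ‖m i h‖ ^ 2) (‖h‖ ^ 2)) :
    ∃ V : H →L[ℂ] l2 K, (∀ h, ‖V h‖ = ‖h‖) ∧ ∀ i h, V h i = m i h := by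
  have hmem : ∀ h, Memℓp (fun i => m i h) 2 := by
    intro h
    refine memℓp_gen ?_
    simpa using (hm h).summable
  let V : H →ₗᵢ[ℂ] l2 K :=
    { toFun := fun h => ⟨fun i => m i h, hmem h⟩
      map_add' := by intro a b; apply lp.ext; funext i; exact map_add (m i) a b
      map_smul' := by intro a b; apply lp.ext; funext i; exact map_smul (m i) a b
      norm_map' := by
        intro h
        have h1 := lp.hasSum_norm (p := 2) (by norm_num) (⟨fun i => m i h, hmem h⟩ : l2 K)
        have h2 : HasSum (fun i => ‖m i h‖ ^ 2) (‖(⟨fun i => m i h, hmem h⟩ : l2 K)‖ ^ 2) := by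
          simpa using h1
        have h3 := h2.unique (hm h)
        exact (pow_left_inj₀ (norm_nonneg _) (norm_nonneg _) two_ne_zero).1 h3 }
  exact ⟨V.toContinuousLinearMap, V.norm_map, fun i h => rfl⟩

theorem exists_V (m : ℕ → (H →L[ℂ] K)) (hm : ∀ h, HasSum (fun i => ‖m i h‖ ^ 2) (‖h‖ ^ 2)) :
    ∃ V : l2 H →L[ℂ] l2 K, (∀ x, adjoint V (V x) = x) ∧
      ∀ (N1 : Set (G →L[ℂ] H)) (N2 : Set (G →L[ℂ] K)),
        (∀ i, ∀ n ∈ N1, m i ∘L n ∈ N2) → (∀ i, ∀ n ∈ N2, adjoint (m i) ∘L n ∈ N1) →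
        (∀ n ∈ N1, n ∈ nullSub (fun n => 1 - ∑ i ∈ Finset.range n, (adjoint (m i)) ∘L (m i))) →
        Mor (col N1) (col N2) V := by
  obtain ⟨V0, hV0, hV0c⟩ := exists_V0 m hm
  have hV0iso : ∀ h, adjoint V0 (V0 h) = h := fun h =>
    congrArg (fun T => T h) ((norm_map_iff_adjoint_comp_self V0).1 hV0)
  have hV0adj : ∀ i k, adjoint V0 (lpSingle i k) = adjoint (m i) k := by
    intro i k
    refine ext_inner_right ℂ fun v => ?_
    rw [adjoint_inner_left, adjoint_inner_left, ← hV0c, ← adj_single, adjoint_inner_right]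
  choose Rr hR0 hR1 hR2 using fun i => reindex (H := K) (fun j => Nat.pair i j)
    (fun a b hab => (Nat.pair_eq_pair.1 hab).2)
  have hRR : ∀ i j, i ≠ j → ∀ y, adjoint (Rr i) (Rr j y) = 0 := by
    intro i j hij y
    have : adjoint (Rr i) ∘L Rr j = 0 := by
      apply ext_single
      intro k a
      simp only [comp_apply]
      rw [hR1, hR2]
      · rfl
      · intro l h; exact hij (Nat.pair_eq_pair.1 h).1
    exact congrArg (fun T => T y) this
  have hRn : ∀ i y, ‖Rr i y‖ = ‖y‖ := by
    intro i
    rw [norm_map_iff_adjoint_comp_self]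
    ext1 y; exact hR0 i y
  obtain ⟨V, hV, hVs⟩ := mkIso (Y := l2 K) (fun i => Rr i ∘L V0)
    (fun i h => by rw [comp_apply, hRn, hV0]) (fun i j hij v w => by
      rw [comp_apply, comp_apply, ← adjoint_inner_right, hRR i j hij, inner_zero_right])
  have hVR : ∀ i y, adjoint V (Rr i y) = lpSingle i (adjoint V0 y) := by
    intro i y
    apply lp.ext
    funext j
    rw [← adj_single]
    refine ext_inner_left ℂ fun v => ?_
    rw [adjoint_inner_right, adjoint_inner_right, hVs, comp_apply, single_coe,
      ← adjoint_inner_left]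
    split_ifs with h
    · subst h; rw [hR0, adjoint_inner_right]
    · rw [hRR _ _ (Ne.symm h)]; simp
  refine ⟨V, hV, fun N1 N2 h1 h2 h3 => ⟨?_, ?_⟩⟩
  · refine col_map _ (csp_closed _) _ fun i n hn => ?_
    have e1 : V ∘L (lpSingle i ∘L n) = Rr i ∘L (V0 ∘L n) := by
      ext1 v; simp only [comp_apply, hVs]
    rw [e1]
    refine (reindex_mor (hR0 i) (hR1 i) (hR2 i) N2).1 _ ?_
    -- norm convergence
    set P : ℕ → (H →L[ℂ] l2 K) := fun N => ∑ j ∈ Finset.range N, lpSingle j ∘L m j with hP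
    set T : ℕ → (H →L[ℂ] H) := fun n => 1 - ∑ i ∈ Finset.range n, (adjoint (m i)) ∘L (m i) with hT
    have hmem : ∀ N, P N ∘L n ∈ col N2 := by
      intro N
      rw [hP, ContinuousLinearMap.finsetSum_comp]
      refine Submodule.sum_mem _ fun j _ => mem_csp ⟨j, m j ∘L n, h1 j n hn, ?_⟩
      rw [ContinuousLinearMap.comp_assoc]
    have hsq : ∀ N h, ‖(V0 - P N) h‖ ^ 2 = RCLike.re ⟪T N h, h⟫_ℂ := by
      intro N h
      have hPh : P N h = ∑ j ∈ Finset.range N, lpSingle j (m j h) := by simp [hP]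
      have hPc : ∀ j ∈ Finset.range N, (P N h) j = m j h := by
        intro j hj
        have hcoe : (P N h) j = ∑ i ∈ Finset.range N, (lpSingle i (m i h) : l2 K) j := by
          rw [← adj_single, hPh, map_sum]
          simp only [adj_single]
        rw [hcoe]
        simp only [single_coe]
        rw [Finset.sum_ite_eq, if_pos hj]
      have hPi : ∀ w : l2 K, ⟪w, P N h⟫_ℂ = ∑ j ∈ Finset.range N, ⟪w j, m j h⟫_ℂ := by
        intro w
        rw [hPh, inner_sum]
        refine Finset.sum_congr rfl fun j _ => ?_
        rw [← adjoint_inner_left, adj_single]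
      have hTh : ⟪T N h, h⟫_ℂ = ⟪h, h⟫_ℂ - ∑ j ∈ Finset.range N, ⟪m j h, m j h⟫_ℂ := by
        simp only [hT, sub_apply, one_apply_eq_self, inner_sub_left]
        congr 1
        rw [_root_.sum_apply, sum_inner]
        refine Finset.sum_congr rfl fun j _ => ?_
        rw [comp_apply, adjoint_inner_left]
      have hPP : ⟪P N h, P N h⟫_ℂ = ∑ j ∈ Finset.range N, ⟪m j h, m j h⟫_ℂ := by
        rw [hPi]
        exact Finset.sum_congr rfl fun j hj => by rw [hPc j hj]
      have hVP : ⟪V0 h, P N h⟫_ℂ = ∑ j ∈ Finset.range N, ⟪m j h, m j h⟫_ℂ := by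
        rw [hPi]
        exact Finset.sum_congr rfl fun j hj => by rw [hV0c]
      rw [sub_apply, @norm_sub_sq ℂ, hVP, ← inner_self_eq_norm_sq (𝕜 := ℂ) (P N h), hPP, hTh, hV0,
        map_sub, inner_self_eq_norm_sq]
      ring
    have hnull : Tendsto (fun N => T N ∘L n) atTop (𝓝 0) := h3 n hn
    have hlim : Tendsto (fun N => P N ∘L n) atTop (𝓝 (V0 ∘L n)) := by
      rw [Metric.tendsto_atTop] at hnull
      refine (tendsto_iff_norm_sub_tendsto_zero (E := G →L[ℂ] l2 K)).2 ?_
      refine Metric.tendsto_atTop.2 ?_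
      intro ε hε
      obtain ⟨N0, hN0⟩ := hnull (ε ^ 2 / (4 * (1 + ‖n‖))) (by positivity)
      refine ⟨N0, fun N hN => ?_⟩
      have hb := hN0 N hN
      rw [dist_zero_right] at hb
      rw [dist_zero_right, norm_norm]
      have : ‖P N ∘L n - V0 ∘L n‖ ≤ ε / 2 := by
        refine opNorm_le_bound _ (by positivity) fun k => ?_
        refine (pow_le_pow_iff_left₀ (norm_nonneg _) (by positivity) two_ne_zero).1 ?_
        have e : ‖(P N ∘L n - V0 ∘L n) k‖ = ‖(V0 - P N) (n k)‖ := norm_sub_rev (E := l2 K) _ _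
        rw [e, hsq]
        calc RCLike.re ⟪T N (n k), n k⟫_ℂ ≤ ‖(T N ∘L n) k‖ * ‖n k‖ := re_inner_le_norm _ _
          _ ≤ (‖T N ∘L n‖ * ‖k‖) * (‖n‖ * ‖k‖) := by gcongr <;> exact le_opNorm _ _
          _ ≤ (ε ^ 2 / (4 * (1 + ‖n‖)) * ‖k‖) * ((1 + ‖n‖) * ‖k‖) := by
              gcongr; linarith
          _ = (ε / 2 * ‖k‖) ^ 2 := by
              have : 1 + ‖n‖ ≠ 0 := by positivity
              field_simp; ring
      exact lt_of_le_of_lt this (by linarith)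
    exact (csp_closed _).mem_of_tendsto hlim (Eventually.of_forall hmem)
  · refine col_map _ (csp_closed _) _ fun k n hn => ?_
    refine mem_csp ⟨(Nat.unpair k).1, adjoint (m (Nat.unpair k).2) ∘L n, h2 _ _ hn, ?_⟩
    ext1 v
    simp only [comp_apply]
    rw [← hV0adj, ← hVR, hR1, Nat.pair_unpair]

theorem exists_split : ∃ s₁ s₂ : l2 H →L[ℂ] l2 H, (∀ x, adjoint s₁ (s₁ x) = x) ∧
    (∀ x, adjoint s₂ (s₂ x) = x) ∧ (∀ x, adjoint s₁ (s₂ x) = 0) ∧ (∀ x, adjoint s₂ (s₁ x) = 0) ∧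
    (∀ x, s₁ (adjoint s₁ x) + s₂ (adjoint s₂ x) = x) ∧
    (∀ N : Set (G →L[ℂ] H), Mor (col N) (col N) s₁) ∧
    (∀ N : Set (G →L[ℂ] H), Mor (col N) (col N) s₂) := by
  obtain ⟨s, a0, a1, a2⟩ := reindex (H := H) (fun i => 2 * i) (fun a b h => by simpa using h)
  obtain ⟨t, b0, b1, b2⟩ := reindex (H := H) (fun i => 2 * i + 1) (fun a b h => by simpa using h)
  have h12 : ∀ i a, adjoint s (lpSingle (2 * i + 1) a) = 0 := fun i a => a2 _ _ fun j => by omega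
  have h21 : ∀ i a, adjoint t (lpSingle (2 * i) a) = 0 := fun i a => b2 _ _ fun j => by omega
  refine ⟨s, t, a0, b0, ?_, ?_, ?_, reindex_mor a0 a1 a2, reindex_mor b0 b1 b2⟩
  · intro x
    have : adjoint s ∘L t = 0 := by
      apply ext_single; intro i a
      simp only [comp_apply]; rw [b1, h12]; rfl
    exact congrArg (fun T => T x) this
  · intro x
    have : adjoint t ∘L s = 0 := by
      apply ext_single; intro i a
      simp only [comp_apply]; rw [a1, h21]; rfl
    exact congrArg (fun T => T x) this
  · intro x
    have : s ∘L adjoint s + t ∘L adjoint t = 1 := by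
      apply ext_single; intro k a
      simp only [comp_apply, add_apply, one_apply_eq_self]
      rcases Nat.even_or_odd' k with ⟨i, rfl | rfl⟩
      · rw [h21, ← a1, a0]; simp
      · rw [h12, ← b1, b0]; simp
    exact congrArg (fun T => T x) this

section mor
variable {X Y Z : Type*} [NormedAddCommGroup X] [InnerProductSpace ℂ X] [CompleteSpace X]
    [NormedAddCommGroup Y] [InnerProductSpace ℂ Y] [CompleteSpace Y]
    [NormedAddCommGroup Z] [InnerProductSpace ℂ Z] [CompleteSpace Z]
    {CX : Submodule ℂ (G →L[ℂ] X)} {CY : Submodule ℂ (G →L[ℂ] Y)} {CZ : Submodule ℂ (G →L[ℂ] Z)}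

theorem Mor.adj {T : X →L[ℂ] Y} (h : Mor CX CY T) : Mor CY CX (adjoint T) :=
  ⟨h.2, by rw [adjoint_adjoint]; exact h.1⟩

theorem Mor.comp {T : X →L[ℂ] Y} {S : Y →L[ℂ] Z} (hS : Mor CY CZ S) (h : Mor CX CY T) :
    Mor CX CZ (S ∘L T) := by
  refine ⟨fun c hc => ?_, fun c hc => ?_⟩
  · rw [ContinuousLinearMap.comp_assoc]
    exact hS.1 (T ∘L c) (h.1 c hc)
  · rw [adjoint_comp, ContinuousLinearMap.comp_assoc]
    exact h.2 (adjoint S ∘L c) (hS.2 c hc)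

theorem Mor.add {T S : X →L[ℂ] Y} (h : Mor CX CY T) (h' : Mor CX CY S) : Mor CX CY (T + S) := by
  refine ⟨fun c hc => ?_, fun c hc => ?_⟩
  · rw [add_comp]; exact Submodule.add_mem _ (h.1 c hc) (h'.1 c hc)
  · rw [map_add, add_comp]; exact Submodule.add_mem _ (h.2 c hc) (h'.2 c hc)

theorem Mor.sub {T S : X →L[ℂ] Y} (h : Mor CX CY T) (h' : Mor CX CY S) : Mor CX CY (T - S) := by
  refine ⟨fun c hc => ?_, fun c hc => ?_⟩
  · rw [sub_comp]; exact Submodule.sub_mem _ (h.1 c hc) (h'.1 c hc)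
  · rw [map_sub, sub_comp]; exact Submodule.sub_mem _ (h.2 c hc) (h'.2 c hc)

theorem adjoint_one' : adjoint (1 : X →L[ℂ] X) = 1 := star_one (R := X →L[ℂ] X)

theorem Mor.one : Mor CX CX (1 : X →L[ℂ] X) :=
  ⟨fun _ hc => hc, fun _ hc => by rw [adjoint_one']; exact hc⟩

theorem exists_unitary {ι : Type*} {CX : ι → Submodule ℂ (G →L[ℂ] X)}
    {CY : ι → Submodule ℂ (G →L[ℂ] Y)}
    (V : X →L[ℂ] Y) (W : Y →L[ℂ] X) (s₁ s₂ : X →L[ℂ] X) (t₁ t₂ : Y →L[ℂ] Y)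
    (hV : ∀ x, adjoint V (V x) = x) (hW : ∀ x, adjoint W (W x) = x)
    (s11 : ∀ x, adjoint s₁ (s₁ x) = x) (s22 : ∀ x, adjoint s₂ (s₂ x) = x)
    (s12 : ∀ x, adjoint s₁ (s₂ x) = 0) (s21 : ∀ x, adjoint s₂ (s₁ x) = 0)
    (ss : ∀ x, s₁ (adjoint s₁ x) + s₂ (adjoint s₂ x) = x)
    (t11 : ∀ x, adjoint t₁ (t₁ x) = x) (t22 : ∀ x, adjoint t₂ (t₂ x) = x)
    (t12 : ∀ x, adjoint t₁ (t₂ x) = 0) (t21 : ∀ x, adjoint t₂ (t₁ x) = 0)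
    (tt : ∀ x, t₁ (adjoint t₁ x) + t₂ (adjoint t₂ x) = x)
    (mV : ∀ i, Mor (CX i) (CY i) V) (mW : ∀ i, Mor (CY i) (CX i) W)
    (ms1 : ∀ i, Mor (CX i) (CX i) s₁) (ms2 : ∀ i, Mor (CX i) (CX i) s₂)
    (mt1 : ∀ i, Mor (CY i) (CY i) t₁) (mt2 : ∀ i, Mor (CY i) (CY i) t₂) :
    ∃ U : X →L[ℂ] Y, (∀ x, adjoint U (U x) = x) ∧ (∀ y, U (adjoint U y) = y) ∧
      ∀ i, Mor (CX i) (CY i) U := by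
  have ss' : ∀ x, s₁ (adjoint s₁ x) = x - s₂ (adjoint s₂ x) := fun x => eq_sub_of_add_eq (ss x)
  have tt' : ∀ x, t₁ (adjoint t₁ x) = x - t₂ (adjoint t₂ x) := fun x => eq_sub_of_add_eq (tt x)
  let P : Y →L[ℂ] Y := 1 - V ∘L adjoint V + V ∘L (s₁ ∘L adjoint V)
  let Q : X →L[ℂ] X := 1 - W ∘L adjoint W + W ∘L (adjoint t₁ ∘L adjoint W)
  let U : X →L[ℂ] Y := P ∘L (adjoint t₂ ∘L adjoint W) + V ∘L (s₂ ∘L Q)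
  have hP : ∀ y, P y = y - V (adjoint V y) + V (s₁ (adjoint V y)) := fun y => by
    simp [P]
  have hQ : ∀ y, Q y = y - W (adjoint W y) + W (adjoint t₁ (adjoint W y)) := fun y => by
    simp [Q]
  have hPa : ∀ y, adjoint P y = y - V (adjoint V y) + V (adjoint s₁ (adjoint V y)) := fun y => by
    simp [P, adjoint_comp, adjoint_one']
  have hQa : ∀ y, adjoint Q y = y - W (adjoint W y) + W (t₁ (adjoint W y)) := fun y => by
    simp [Q, adjoint_comp, adjoint_one']
  have hU : ∀ x, U x = P (adjoint t₂ (adjoint W x)) + V (s₂ (Q x)) := fun y => by simp [U]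
  have hUa : ∀ y, adjoint U y = W (t₂ (adjoint P y)) + adjoint Q (adjoint s₂ (adjoint V y)) :=
    fun y => by simp [U, adjoint_comp]
  refine ⟨U, ?_, ?_, fun i => ?_⟩
  · intro x
    rw [hUa, hU]
    simp only [hPa, hP, hQa, hQ, map_add, map_sub, hV, hW, s11, s22, s12, s21, t11, t22, t12, t21,
      ss', tt', map_zero]
    abel
  · intro x
    rw [hU, hUa]
    simp only [hPa, hP, hQa, hQ, map_add, map_sub, hV, hW, s11, s22, s12, s21, t11, t22, t12, t21,
      ss', tt', map_zero]
    abel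
  · have mP : Mor (CY i) (CY i) P :=
      (Mor.one.sub ((mV i).comp (mV i).adj)).add ((mV i).comp ((ms1 i).comp (mV i).adj))
    have mQ : Mor (CX i) (CX i) Q :=
      (Mor.one.sub ((mW i).comp (mW i).adj)).add ((mW i).comp ((mt1 i).adj.comp (mW i).adj))
    exact (mP.comp ((mt2 i).adj.comp (mW i).adj)).add ((mV i).comp ((ms2 i).comp mQ))

end mor

theorem matrixOp_apply {n : ℕ} (x : Fin n → Fin n → (R →L[ℂ] R)) (v : PiLp 2 fun _ : Fin n => R)
    (i : Fin n) : matrixOp x v i = ∑ j, x i j (v j) := by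
  simp [matrixOp]

theorem matrixOp_le {n : ℕ} (U : H →L[ℂ] K) (hU : ∀ x, ‖U x‖ = ‖x‖)
    (hU' : ∀ x, ‖adjoint U x‖ = ‖x‖) (x : Fin n → Fin n → (H →L[ℂ] H)) :
    ‖matrixOp (fun i j => U ∘L (x i j ∘L adjoint U))‖ ≤ ‖matrixOp x‖ := by
  refine opNorm_le_bound _ (norm_nonneg _) fun v => ?_
  let w : PiLp 2 fun _ : Fin n => H := WithLp.toLp 2 fun j => adjoint U (v j)
  have hw : ‖w‖ = ‖v‖ := by
    rw [PiLp.norm_eq_of_L2, PiLp.norm_eq_of_L2]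
    simp [w, hU']
  have h1 : ‖matrixOp (fun i j => U ∘L (x i j ∘L adjoint U)) v‖ = ‖matrixOp x w‖ := by
    rw [PiLp.norm_eq_of_L2, PiLp.norm_eq_of_L2]
    simp only [matrixOp_apply, comp_apply, ← map_sum, hU]
    rfl
  rw [h1, ← hw]
  exact le_opNorm _ _

theorem adj_isTRO {M : Set (H →L[ℂ] K)} (hM : IsTRO M) : IsTRO (adjoint ⁻¹' M) := by
  obtain ⟨⟨hc, p, rfl⟩, h3⟩ := hM
  refine ⟨⟨hc.preimage (by fun_prop), 
    { carrier := adjoint ⁻¹' (p : Set (H →L[ℂ] K))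
      zero_mem' := by simp
      add_mem' := by
        intro a b ha hb
        simp only [Set.mem_preimage, map_add]
        exact p.add_mem ha hb
      smul_mem' := by
        intro c a ha
        simp only [Set.mem_preimage, map_smulₛₗ]
        exact p.smul_mem _ ha }, rfl⟩, ?_⟩
  intro a ha b hb c hc
  have := h3 _ hc _ hb _ ha
  simpa [adjoint_comp, ContinuousLinearMap.comp_assoc] using this

theorem conjTRO'_eq (M : Set (H →L[ℂ] K)) (A : Set (H →L[ℂ] H)) :
    conjTRO' M A = conjTRO (adjoint ⁻¹' M) A := by
  unfold conjTRO' conjTRO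
  congr 1
  ext x
  constructor
  · rintro ⟨m₁, h1, m₂, h2, a, ha, rfl⟩
    exact ⟨adjoint m₁, by simpa using h1, adjoint m₂, by simpa using h2, a, ha, by simp⟩
  · rintro ⟨m₁, h1, m₂, h2, a, ha, rfl⟩
    exact ⟨adjoint m₁, h1, adjoint m₂, h2, a, ha, by simp⟩

theorem conj_left {M : Set (H →L[ℂ] K)} (hM : IsTRO M) {A : Set (H →L[ℂ] H)}
    {B : Set (K →L[ℂ] K)} (hAB : A = conjTRO M B) {m m' : H →L[ℂ] K} (hm : m ∈ M) (hm' : m' ∈ M)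
    {a : H →L[ℂ] H} (ha : a ∈ A) : adjoint m ∘L (m' ∘L a) ∈ A := by
  rw [hAB] at ha ⊢
  refine mem_clspan_iff.2 (csp_map (csp _) (csp_closed _) (fun y => adjoint m ∘L (m' ∘L y))
    (by fun_prop) (by intros; simp) (fun c _ => ⟨c, by simp⟩) ?_ (mem_clspan_iff.1 ha))
  rintro s ⟨m₁, h1, m₂, h2, b, hb, rfl⟩
  refine mem_csp ⟨_, hM.2 m₁ h1 m' hm' m hm, m₂, h2, b, hb, ?_⟩
  simp [adjoint_comp, ContinuousLinearMap.comp_assoc]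

theorem conj_right {M : Set (H →L[ℂ] K)} (hM : IsTRO M) {A : Set (H →L[ℂ] H)}
    {B : Set (K →L[ℂ] K)} (hAB : A = conjTRO M B) {m m' : H →L[ℂ] K} (hm : m ∈ M) (hm' : m' ∈ M)
    {a : H →L[ℂ] H} (ha : a ∈ A) : a ∘L (adjoint m ∘L m') ∈ A := by
  rw [hAB] at ha ⊢
  refine mem_clspan_iff.2 (csp_map (csp _) (csp_closed _) (fun y => y ∘L (adjoint m ∘L m'))
    (by fun_prop) (by intros; simp) (fun c _ => ⟨c, by simp⟩) ?_ (mem_clspan_iff.1 ha))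
  rintro s ⟨m₁, h1, m₂, h2, b, hb, rfl⟩
  exact mem_csp ⟨m₁, h1, _, hM.2 m₂ h2 m hm m' hm', b, hb, rfl⟩

theorem kinf_of_col {N N' : Set (G →L[ℂ] H)} {A : Set (H →L[ℂ] H)}
    (h : ∀ n ∈ N, ∀ n' ∈ N', n ∘L adjoint n' ∈ A) {c d : G →L[ℂ] l2 H} (hc : c ∈ col N)
    (hd : d ∈ col N') : c ∘L adjoint d ∈ Kinf A := by
  refine mem_clspan_iff.2 (csp_map (csp _) (csp_closed _) (fun y => y ∘L adjoint d)
    (by fun_prop) (by intros; simp) (fun c _ => ⟨c, by simp⟩) ?_ hc)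
  rintro s ⟨i, n, hn, rfl⟩
  refine csp_map (csp _) (csp_closed _) (fun y => (lpSingle i ∘L n) ∘L adjoint y)
    (by fun_prop) (by intros; simp) (fun c _ => ⟨starRingEnd ℂ c, by simp [map_smulₛₗ]⟩) ?_ hd
  rintro s ⟨j, n', hn', rfl⟩
  refine mem_csp ⟨_, h n hn n' hn', i, j, ?_⟩
  simp [adjoint_comp, ContinuousLinearMap.comp_assoc]

/-- the two coefficient sets -/
def Bs (B : Set (K →L[ℂ] K)) : Bool → Set (K →L[ℂ] K)
  | true => B
  | false => adjoint ⁻¹' B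

/-- the module over `H` -/
def Ns (M : Set (H →L[ℂ] K)) (B : Set (K →L[ℂ] K)) (i : Bool) : Set (K →L[ℂ] H) :=
  {z | ∃ m ∈ M, ∃ b ∈ Bs B i, z = adjoint m ∘L b}

theorem Bs_ideal {M : Set (H →L[ℂ] K)} (hM : IsTRO M) {A : Set (H →L[ℂ] H)}
    {B : Set (K →L[ℂ] K)} (hBA : B = conjTRO (adjoint ⁻¹' M) A) (i : Bool)
    {m m' : H →L[ℂ] K} (hm : m ∈ M) (hm' : m' ∈ M) {b : K →L[ℂ] K} (hb : b ∈ Bs B i) :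
    m ∘L (adjoint m' ∘L b) ∈ Bs B i := by
  have h1 : adjoint m ∈ adjoint ⁻¹' M := by simpa using hm
  have h2 : adjoint m' ∈ adjoint ⁻¹' M := by simpa using hm'
  cases i with
  | true =>
    have := conj_left (adj_isTRO hM) hBA h1 h2 hb
    rw [adjoint_adjoint] at this
    exact this
  | false =>
    have := conj_right (adj_isTRO hM) hBA h2 h1 hb
    show adjoint _ ∈ B
    simpa [adjoint_comp, ContinuousLinearMap.comp_assoc] using this

theorem Ns_null {M : Set (H →L[ℂ] K)} (hM : IsTRO M) {A : Set (H →L[ℂ] H)}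
    {B : Set (K →L[ℂ] K)} (hAB : A = conjTRO M B) (hBA : B = conjTRO (adjoint ⁻¹' M) A)
    (T : ℕ → (H →L[ℂ] H)) (hT : ∀ n, ‖T n‖ ≤ 1) (h1 : ∀ a ∈ A, a ∈ nullSub T)
    (h2 : ∀ a ∈ A, adjoint a ∈ nullSub T) (i : Bool) : ∀ n ∈ Ns M B i, n ∈ nullSub T := by
  rintro n ⟨m, hm, b, hb, rfl⟩
  cases i with
  | true =>
    have hb' : b ∈ B := hb
    rw [hBA] at hb'
    refine csp_map (nullSub T) (nullSub_closed T hT) (fun y => adjoint m ∘L y)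
      (by fun_prop) (by intros; simp) (fun c _ => ⟨c, by simp⟩) ?_ (mem_clspan_iff.1 hb')
    rintro s ⟨m₁, k1, m₂, k2, a, ha, rfl⟩
    exact nullSub_comp T (h1 _ (conj_left hM hAB hm k1 ha)) m₂
  | false =>
    have hb' : adjoint b ∈ B := hb
    rw [hBA] at hb'
    have := csp_map (nullSub T) (nullSub_closed T hT) (fun y => adjoint m ∘L adjoint y)
      (by fun_prop) (by intros; simp) (fun c _ => ⟨starRingEnd ℂ c, by simp [map_smulₛₗ]⟩) ?_
      (mem_clspan_iff.1 hb')
    · simpa using this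
    rintro s ⟨m₁, k1, m₂, k2, a, ha, rfl⟩
    have := nullSub_comp T (h2 _ (conj_right hM hAB k2 hm ha)) m₁
    simpa [adjoint_comp, ContinuousLinearMap.comp_assoc] using this

theorem Bs_null {A : Set (H →L[ℂ] H)} (T : ℕ → (H →L[ℂ] H)) (h1 : ∀ a ∈ A, a ∈ nullSub T)
    (h2 : ∀ a ∈ A, adjoint a ∈ nullSub T) (i : Bool) : ∀ n ∈ Bs A i, n ∈ nullSub T := by
  intro n hn
  cases i with
  | true => exact h1 n hn
  | false =>
    have := h2 _ hn
    rwa [adjoint_adjoint] at this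

section tr
variable {X Y Z₁ Z₂ : Type*} [NormedAddCommGroup X] [InnerProductSpace ℂ X]
    [NormedAddCommGroup Y] [InnerProductSpace ℂ Y]
    [NormedAddCommGroup Z₁] [InnerProductSpace ℂ Z₁] [NormedAddCommGroup Z₂] [InnerProductSpace ℂ Z₂]

theorem csp_conj {S : Set (X →L[ℂ] Y)} (P : Set (Z₁ →L[ℂ] Z₂))
    (l : Y →L[ℂ] Z₂) (r : Z₁ →L[ℂ] X) (h : ∀ s ∈ S, l ∘L (s ∘L r) ∈ clspan P) {x : X →L[ℂ] Y}
    (hx : x ∈ clspan S) : l ∘L (x ∘L r) ∈ clspan P :=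
  mem_clspan_iff.2 (csp_map (csp P) (csp_closed P) (fun y => l ∘L (y ∘L r))
    (by fun_prop) (by intros; simp) (fun c _ => ⟨c, by simp⟩)
    (fun s hs => mem_clspan_iff.1 (h s hs)) (mem_clspan_iff.1 hx))

theorem lim_conj (P : Set (Z₁ →L[ℂ] Z₂)) (l : Y →L[ℂ] Z₂) (r : Z₁ →L[ℂ] Y)
    (f : ℕ → (Y →L[ℂ] Y)) (b : Y →L[ℂ] Y)
    (hf : Filter.Tendsto (fun n => f n * b) Filter.atTop (nhds b))
    (h : ∀ n, (l ∘L f n) ∘L (b ∘L r) ∈ clspan P) : l ∘L (b ∘L r) ∈ clspan P := by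
  have hcont : Continuous (fun y : Y →L[ℂ] Y => l ∘L (y ∘L r)) := by fun_prop
  have ht := (hcont.tendsto b).comp hf
  exact isClosed_closure.mem_of_tendsto ht (Filter.Eventually.of_forall h)

theorem asc0 {Z₃ Z₄ : Type*} [NormedAddCommGroup Z₃] [InnerProductSpace ℂ Z₃]
    [NormedAddCommGroup Z₄] [InnerProductSpace ℂ Z₄] (u : Z₃ →L[ℂ] Z₄) (s : Z₂ →L[ℂ] Z₃)
    (a : Z₁ →L[ℂ] Z₂) (t : Y →L[ℂ] Z₁) (v : X →L[ℂ] Y) :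
    u ∘L ((s ∘L (a ∘L t)) ∘L v) = (u ∘L s) ∘L (a ∘L (t ∘L v)) := rfl

theorem asc1 {Z₃ Z₄ : Type*} [NormedAddCommGroup Z₃] [InnerProductSpace ℂ Z₃]
    [NormedAddCommGroup Z₄] [InnerProductSpace ℂ Z₄] {Z₅ : Type*} [NormedAddCommGroup Z₅]
    [InnerProductSpace ℂ Z₅] (u : Z₃ →L[ℂ] Z₄) (w : Z₅ →L[ℂ] Z₃) (s : Z₂ →L[ℂ] Z₅)
    (a : Z₁ →L[ℂ] Z₂) (t : Y →L[ℂ] Z₁) (v : X →L[ℂ] Y) :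
    (u ∘L w) ∘L ((s ∘L (a ∘L t)) ∘L v) = (u ∘L (w ∘L s)) ∘L (a ∘L (t ∘L v)) := rfl

theorem asc2 [CompleteSpace X] [CompleteSpace Y] [CompleteSpace Z₁] [CompleteSpace Z₂]
    (U : Z₁ →L[ℂ] Z₂) (s t : Y →L[ℂ] Z₁) (m₁ m₂ : Y →L[ℂ] X) (f b : X →L[ℂ] X) :
    (U ∘L (s ∘L (adjoint m₁ ∘L f))) ∘L adjoint (U ∘L (t ∘L (adjoint m₂ ∘L adjoint b))) =
      ((U ∘L (s ∘L adjoint m₁)) ∘L f) ∘L (b ∘L (m₂ ∘L (adjoint t ∘L adjoint U))) := by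
  rw [adjoint_comp, adjoint_comp, adjoint_comp, adjoint_adjoint, adjoint_adjoint]
  rfl

theorem asc3 [CompleteSpace X] [CompleteSpace Z₁] [CompleteSpace Z₂]
    (U : Z₂ →L[ℂ] Z₁) (s t : X →L[ℂ] Z₁) (f b : X →L[ℂ] X) :
    (adjoint U ∘L (s ∘L f)) ∘L adjoint (adjoint U ∘L (t ∘L adjoint b)) =
      ((adjoint U ∘L s) ∘L f) ∘L (b ∘L (adjoint t ∘L U)) := by
  rw [adjoint_comp, adjoint_comp, adjoint_adjoint, adjoint_adjoint]
  rfl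

end tr

theorem kinf_conj {A : Set (H →L[ℂ] H)} {B : Set (K →L[ℂ] K)} (U : l2 H →L[ℂ] l2 K)
    (U' : l2 K →L[ℂ] l2 H) (hh : ∀ a ∈ A, ∀ i j,
      (U ∘L lpSingle i) ∘L (a ∘L (adjoint (lpSingle j) ∘L U')) ∈ Kinf B) :
    ∀ x ∈ Kinf A, U ∘L (x ∘L U') ∈ Kinf B := by
  intro x hx
  refine csp_conj _ U U' ?_ hx
  rintro s ⟨a, ha, i, j, rfl⟩
  rw [asc0]
  exact hh a ha i j

theorem tro_conj {M : Set (H →L[ℂ] K)} {A : Set (H →L[ℂ] H)} {B : Set (K →L[ℂ] K)}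
    (hAB : A = conjTRO M B) (u : H →L[ℂ] l2 K) (v : l2 K →L[ℂ] H)
    (hh : ∀ b ∈ B, ∀ m₁ ∈ M, ∀ m₂ ∈ M, u ∘L ((adjoint m₁ ∘L (b ∘L m₂)) ∘L v) ∈ Kinf B) :
    ∀ a ∈ A, u ∘L (a ∘L v) ∈ Kinf B := by
  intro a ha
  rw [hAB] at ha
  refine csp_conj _ _ _ ?_ ha
  rintro s ⟨m₁, h1, m₂, h2, b, hb, rfl⟩
  exact hh b hb m₁ h1 m₂ h2

theorem Bs_mul {B : Set (K →L[ℂ] K)} (hB : IsClosedSubalgebra B) :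
    ∀ n ∈ Bs B true, ∀ n' ∈ Bs B false, n ∘L adjoint n' ∈ B := by
  intro n hn n' hn'
  have h1 : n ∈ B := hn
  have h2 : adjoint n' ∈ B := hn'
  exact hB.2 n h1 _ h2

theorem mem_Bs_false {B : Set (K →L[ℂ] K)} (b : K →L[ℂ] K) : b ∈ Bs B false ↔ adjoint b ∈ B :=
  Iff.rfl

theorem adj_Bs {B : Set (K →L[ℂ] K)} {b : K →L[ℂ] K} (hb : b ∈ B) : adjoint b ∈ Bs B false := by
  rw [mem_Bs_false, adjoint_adjoint]
  exact hb

theorem kinf_lim {B : Set (K →L[ℂ] K)} {A : Set (H →L[ℂ] H)} (l : K →L[ℂ] l2 H)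
    (r : l2 H →L[ℂ] K) (f : ℕ → (K →L[ℂ] K))
    (hfl : ∀ b ∈ B, Filter.Tendsto (fun n => f n * b) Filter.atTop (nhds b))
    (b : K →L[ℂ] K) (hb : b ∈ B)
    (hh : ∀ n, (l ∘L f n) ∘L (b ∘L r) ∈ Kinf A) : l ∘L (b ∘L r) ∈ Kinf A :=
  lim_conj _ l r f b (hfl b hb) hh

theorem fwd_col {M : Set (H →L[ℂ] K)} {B : Set (K →L[ℂ] K)} (U : l2 H →L[ℂ] l2 K) (t : Bool)
    (mU : Mor (col (Ns M B t)) (col (Bs B t)) U) (b : K →L[ℂ] K) (hb : b ∈ Bs B t)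
    (m₁ : H →L[ℂ] K) (h1 : m₁ ∈ M) (i : ℕ) :
    U ∘L (lpSingle i ∘L (adjoint m₁ ∘L b)) ∈ col (Bs B t) :=
  mU.1 _ (mem_csp ⟨i, _, ⟨m₁, h1, b, hb, rfl⟩, rfl⟩)

theorem bwd_col {M : Set (H →L[ℂ] K)} {B : Set (K →L[ℂ] K)} (U : l2 H →L[ℂ] l2 K) (t : Bool)
    (mU : Mor (col (Ns M B t)) (col (Bs B t)) U) (b : K →L[ℂ] K) (hb : b ∈ Bs B t) (i : ℕ) :
    adjoint U ∘L (lpSingle i ∘L b) ∈ col (Ns M B t) :=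
  mU.2 _ (mem_csp ⟨i, _, hb, rfl⟩)

theorem fwd_fin {B : Set (K →L[ℂ] K)} (U : l2 H →L[ℂ] l2 K) (m₁ m₂ : H →L[ℂ] K)
    (f b : K →L[ℂ] K) (i j : ℕ)
    (h3 : (U ∘L (lpSingle i ∘L (adjoint m₁ ∘L f))) ∘L
      adjoint (U ∘L (lpSingle j ∘L (adjoint m₂ ∘L adjoint b))) ∈ Kinf B) :
    ((U ∘L (lpSingle i ∘L adjoint m₁)) ∘L f) ∘L
      (b ∘L (m₂ ∘L (adjoint (lpSingle j) ∘L adjoint U))) ∈ Kinf B := by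
  rw [asc2] at h3
  exact h3

theorem bwd_fin {A : Set (H →L[ℂ] H)} (U : l2 H →L[ℂ] l2 K) (f b : K →L[ℂ] K) (i j : ℕ)
    (h3 : (adjoint U ∘L (lpSingle i ∘L f)) ∘L
      adjoint (adjoint U ∘L (lpSingle j ∘L adjoint b)) ∈ Kinf A) :
    ((adjoint U ∘L lpSingle i) ∘L f) ∘L (b ∘L (adjoint (lpSingle j) ∘L U)) ∈ Kinf A := by
  rw [asc3] at h3
  exact h3

theorem Ns_mul {M : Set (H →L[ℂ] K)} {A : Set (H →L[ℂ] H)} {B : Set (K →L[ℂ] K)}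
    (hB : IsClosedSubalgebra B) (hAB : A = conjTRO M B) :
    ∀ n ∈ Ns M B true, ∀ n' ∈ Ns M B false, n ∘L adjoint n' ∈ A := by
  rintro n ⟨m₁, h1, b₁, hb₁, rfl⟩ n' ⟨m₂, h2, b₂, hb₂, rfl⟩
  rw [hAB]
  refine mem_clspan_iff.2 (mem_csp ⟨m₁, h1, m₂, h2, b₁ ∘L adjoint b₂, Bs_mul hB _ hb₁ _ hb₂, ?_⟩)
  rw [adjoint_comp, adjoint_adjoint]
  simp only [ContinuousLinearMap.comp_assoc]

theorem fwd_asc {B : Set (K →L[ℂ] K)} (U : l2 H →L[ℂ] l2 K) (m₁ m₂ : H →L[ℂ] K)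
    (b : K →L[ℂ] K) (i j : ℕ)
    (h3 : (U ∘L (lpSingle i ∘L adjoint m₁)) ∘L
      (b ∘L (m₂ ∘L (adjoint (lpSingle j) ∘L adjoint U))) ∈ Kinf B) :
    (U ∘L lpSingle i) ∘L ((adjoint m₁ ∘L (b ∘L m₂)) ∘L (adjoint (lpSingle j) ∘L adjoint U)) ∈
      Kinf B := by
  rw [asc1]
  exact h3

theorem fwd_aux {M : Set (H →L[ℂ] K)} {A : Set (H →L[ℂ] H)} {B : Set (K →L[ℂ] K)}
    (hB : IsClosedSubalgebra B) (hAB : A = conjTRO M B) (U : l2 H →L[ℂ] l2 K)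
    (mU : ∀ i, Mor (col (Ns M B i)) (col (Bs B i)) U)
    (f : ℕ → (K →L[ℂ] K)) (hfB : ∀ n, f n ∈ B)
    (hfl : ∀ b ∈ B, Filter.Tendsto (fun n => f n * b) Filter.atTop (nhds b)) :
    ∀ x ∈ Kinf A, U ∘L (x ∘L adjoint U) ∈ Kinf B := by
  refine kinf_conj U (adjoint U) fun a ha i j => ?_
  refine tro_conj hAB _ _ (fun b hb m₁ h1 m₂ h2 => ?_) a ha
  refine fwd_asc U m₁ m₂ b i j ?_
  refine kinf_lim _ _ f hfl b hb fun n => ?_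
  exact fwd_fin U m₁ m₂ (f n) b i j (kinf_of_col (Bs_mul hB)
    (fwd_col U true (mU true) (f n) (hfB n) m₁ h1 i)
    (fwd_col U false (mU false) (adjoint b) (adj_Bs hb) m₂ h2 j))

theorem bwd_aux {M : Set (H →L[ℂ] K)} {A : Set (H →L[ℂ] H)} {B : Set (K →L[ℂ] K)}
    (hB : IsClosedSubalgebra B) (hAB : A = conjTRO M B) (U : l2 H →L[ℂ] l2 K)
    (mU : ∀ i, Mor (col (Ns M B i)) (col (Bs B i)) U)
    (f : ℕ → (K →L[ℂ] K)) (hfB : ∀ n, f n ∈ B)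
    (hfl : ∀ b ∈ B, Filter.Tendsto (fun n => f n * b) Filter.atTop (nhds b)) :
    ∀ x ∈ Kinf B, adjoint U ∘L (x ∘L U) ∈ Kinf A := by
  refine kinf_conj (adjoint U) U fun b hb i j => ?_
  refine kinf_lim _ _ f hfl b hb fun n => ?_
  exact bwd_fin U (f n) b i j (kinf_of_col (Ns_mul hB hAB)
    (bwd_col U true (mU true) (f n) (hfB n) i)
    (bwd_col U false (mU false) (adjoint b) (adj_Bs hb) j))

end aux
/-- Strongly TRO equivalent operator algebras with countable approximate
identities are strongly stably isomorphic: there is a bijective, completely isometric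
algebra isomorphism of `K_∞(A)` onto `K_∞(B)`. -/
theorem strongTRO_implies_stably_isomorphic
    (A : Set (H →L[ℂ] H)) (B : Set (K →L[ℂ] K))
    (hA : IsClosedSubalgebra A) (hB : IsClosedSubalgebra B)
    (hAnd : Nondegenerate A) (hBnd : Nondegenerate B)
    (hAai : HasCountableAI A) (hBai : HasCountableAI B)
    (M : Set (H →L[ℂ] K)) (hM : IsTRO M)
    (hAB : A = conjTRO M B) (hBA : B = conjTRO' M A) :
    ∃ φ : (l2 H →L[ℂ] l2 H) → (l2 K →L[ℂ] l2 K),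
      Set.BijOn φ (Kinf A) (Kinf B) ∧
      (∀ x ∈ Kinf A, ∀ y ∈ Kinf A, φ (x + y) = φ x + φ y) ∧
      (∀ (c : ℂ), ∀ x ∈ Kinf A, φ (c • x) = c • φ x) ∧
      (∀ x ∈ Kinf A, ∀ y ∈ Kinf A, φ (x * y) = φ x * φ y) ∧
      CompletelyIsometricOn (Kinf A) φ := by
  rw [conjTRO'_eq] at hBA
  obtain ⟨m, hmM, hmsum, hmT, hmA, hmA'⟩ := exists_seq hM hAB hAnd hAai
  obtain ⟨k, hkM, hksum, hkT, hkB, hkB'⟩ := exists_seq (adj_isTRO hM) hBA hBnd hBai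
  obtain ⟨V, hV, mV⟩ := exists_V (G := K) m hmsum
  obtain ⟨W, hW, mW⟩ := exists_V (G := K) k hksum
  obtain ⟨s₁, s₂, s11, s22, s12, s21, ss, ms1, ms2⟩ := exists_split (H := H) (G := K)
  obtain ⟨t₁, t₂, t11, t22, t12, t21, tt, mt1, mt2⟩ := exists_split (H := K) (G := K)
  obtain ⟨U, hU1, hU2, mU⟩ := exists_unitary (CX := fun i => col (Ns M B i))
    (CY := fun i => col (Bs B i)) V W s₁ s₂ t₁ t₂ hV hW s11 s22 s12 s21 ss t11 t22 t12 t21 tt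
    (fun i => mV _ _
      (by rintro j n ⟨m', hm', b, hb, rfl⟩; exact Bs_ideal hM hBA i (hmM j) hm' hb)
      (by intro j n hn; exact ⟨m j, hmM j, n, hn, rfl⟩)
      (Ns_null hM hAB hBA _ hmT hmA hmA' i))
    (fun i => mW _ _
      (by intro j n hn; exact ⟨adjoint (k j), hkM j, n, hn, by simp⟩)
      (by rintro j n ⟨m', hm', b, hb, rfl⟩; exact Bs_ideal hM hBA i (hkM j) hm' hb)
      (Bs_null _ hkB hkB' i))
    (fun i => ms1 _) (fun i => ms2 _) (fun i => mt1 _) (fun i => mt2 _)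
  have hUU1 : adjoint U ∘L U = 1 := by ext1 x; exact hU1 x
  have hUU2 : U ∘L adjoint U = 1 := by ext1 x; exact hU2 x
  have nU : ∀ x, ‖U x‖ = ‖x‖ := (norm_map_iff_adjoint_comp_self U).2 hUU1
  have nU' : ∀ x, ‖adjoint U x‖ = ‖x‖ :=
    (norm_map_iff_adjoint_comp_self (adjoint U)).2 (by rw [adjoint_adjoint]; exact hUU2)
  obtain ⟨f, hfB, hf⟩ := hBai
  have hfl : ∀ b ∈ B, Filter.Tendsto (fun n => f n * b) Filter.atTop (nhds b) := fun b hb =>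
    tendsto_iff_norm_sub_tendsto_zero.2 (hf b hb).1
  have fwd := fwd_aux hB hAB U mU f hfB hfl
  have bwd := bwd_aux hB hAB U mU f hfB hfl
  have inv1 : ∀ x : l2 H →L[ℂ] l2 H, adjoint U ∘L ((U ∘L (x ∘L adjoint U)) ∘L U) = x := by
    intro x; ext1 v; simp only [comp_apply, hU1]
  have inv2 : ∀ x : l2 K →L[ℂ] l2 K, U ∘L ((adjoint U ∘L (x ∘L U)) ∘L adjoint U) = x := by
    intro x; ext1 v; simp only [comp_apply, hU2]
  refine ⟨fun x => U ∘L (x ∘L adjoint U), ⟨fwd, ?_, ?_⟩, ?_, ?_, ?_, ?_⟩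
  · intro x _ y _ hxy
    rw [← inv1 x, ← inv1 y]
    exact congrArg (fun z => adjoint U ∘L (z ∘L U)) hxy
  · intro y hy
    exact ⟨_, bwd y hy, inv2 y⟩
  · intro x _ y _; simp
  · intro c x _; simp
  · intro x _ y _
    ext1 v
    simp only [comp_apply, ContinuousLinearMap.mul_def, hU1]
  · intro n x _
    refine le_antisymm (matrixOp_le U nU nU' x) ?_
    have := matrixOp_le (adjoint U) nU' (by rw [adjoint_adjoint]; exact nU)
      (fun i j => U ∘L (x i j ∘L adjoint U))
    simpa only [adjoint_adjoint, inv1] using this
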